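/- arXiv:1510.00328 — 2 statements merged into one kernel-verified Lean document; each statement's English description precedes it below -/
import Mathlib

section
/- Fix an integer n ≥ 1, λ ∈ {−1, 1}, t* ∈ ℝ and x* ∈ Eⁿ, and let φ, ψ : ℝ × Eⁿ → ℝ be twice continuously differentiable. Write Φ(x) = φ(t* + λ‖x − x*‖, x), Ψ(x) = ψ(t* + λ‖x − x*‖, x), x'ᵢ = xᵢ − x*ᵢ, r = ‖x − x*‖, and for i = 1,…,n set Lᵢ(x) = Φ(x)·[(∂ᵢψ)(t* + λr, x) − λ(x'ᵢ/r)·(∂_tψ)(t* + λr, x)]. Then for every x ≠ x*: Φ(x)·(□ψ)(t* + λr, x) − (λ/r)·[(n − 1)Φ(x) + 2·Σ_{i=1}^n x'ᵢ·∂ᵢΦ(x)]·(∂_tψ)(t* + λr, x) + Σ_{i=1}^n ∂ᵢΦ(x)·∂ᵢΨ(x) − Σ_{i=1}^n ∂ᵢLᵢ(x) = 0. -/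
open MeasureTheory Real Filter

noncomputable def pd {n : ℕ} (i : Fin n) (f : EuclideanSpace ℝ (Fin n) → ℝ)
    (x : EuclideanSpace ℝ (Fin n)) : ℝ :=
  fderiv ℝ f x (EuclideanSpace.single i 1)

noncomputable def pdT {n : ℕ} (ψ : ℝ × EuclideanSpace ℝ (Fin n) → ℝ)
    (p : ℝ × EuclideanSpace ℝ (Fin n)) : ℝ :=
  deriv (fun s => ψ (s, p.2)) p.1

noncomputable def pdX {n : ℕ} (i : Fin n) (ψ : ℝ × EuclideanSpace ℝ (Fin n) → ℝ)
    (p : ℝ × EuclideanSpace ℝ (Fin n)) : ℝ :=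
  fderiv ℝ (fun y => ψ (p.1, y)) p.2 (EuclideanSpace.single i 1)

noncomputable def dAlem {n : ℕ} (ψ : ℝ × EuclideanSpace ℝ (Fin n) → ℝ)
    (p : ℝ × EuclideanSpace ℝ (Fin n)) : ℝ :=
  (∑ i, pdX i (pdX i ψ) p) - pdT (pdT ψ) p

lemma pdT_eq {n : ℕ} (F : ℝ × EuclideanSpace ℝ (Fin n) → ℝ) (hF : Differentiable ℝ F)
    (p : ℝ × EuclideanSpace ℝ (Fin n)) : pdT F p = fderiv ℝ F p (1, 0) := by
  unfold pdT
  have h : HasDerivAt (fun s : ℝ => ((s, p.2) : ℝ × EuclideanSpace ℝ (Fin n))) (1, 0) p.1 :=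
    (hasDerivAt_id _).prodMk (hasDerivAt_const _ _)
  exact ((hF (p.1, p.2)).hasFDerivAt.comp_hasDerivAt p.1 h).deriv

lemma pdX_eq {n : ℕ} (i : Fin n) (F : ℝ × EuclideanSpace ℝ (Fin n) → ℝ) (hF : Differentiable ℝ F)
    (p : ℝ × EuclideanSpace ℝ (Fin n)) :
    pdX i F p = fderiv ℝ F p (0, EuclideanSpace.single i 1) := by
  unfold pdX
  have h := (hF (p.1, p.2)).hasFDerivAt.comp p.2 (hasFDerivAt_prodMk_right (𝕜 := ℝ) p.1 p.2)
  have h2 : fderiv ℝ (fun y => F (p.1, y)) p.2 = _ := h.fderiv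
  rw [h2]; simp

lemma pd_norm {n : ℕ} (xs x : EuclideanSpace ℝ (Fin n)) (hx : x ≠ xs) :
    ∃ N : EuclideanSpace ℝ (Fin n) →L[ℝ] ℝ, HasFDerivAt (fun y => ‖y - xs‖) N x ∧
      ∀ i, N (EuclideanSpace.single i 1) = (x i - xs i) / ‖x - xs‖ := by
  have hr : ‖x - xs‖ ≠ 0 := norm_ne_zero_iff.2 (sub_ne_zero.2 hx)
  have h1 := ((hasFDerivAt_id (𝕜 := ℝ) x).sub_const xs).norm_sq.sqrt (by simpa using hr)
  refine ⟨_, h1.congr_of_eventuallyEq (Filter.Eventually.of_forall fun y => ?_), fun i => ?_⟩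
  · simp
  · have : inner ℝ (x - xs) (EuclideanSpace.single i (1 : ℝ)) = x i - xs i := by
      rw [EuclideanSpace.inner_single_right]; simp
    simp [-inner_sub_left, -map_sub, this]
    try field_simp

lemma pd_cone {n : ℕ} (lam ts : ℝ) (xs x : EuclideanSpace ℝ (Fin n)) (hx : x ≠ xs)
    (F : ℝ × EuclideanSpace ℝ (Fin n) → ℝ) (hF : Differentiable ℝ F) :
    DifferentiableAt ℝ (fun y => F (ts + lam * ‖y - xs‖, y)) x ∧ ∀ i,
    pd i (fun y => F (ts + lam * ‖y - xs‖, y)) x = pdX i F (ts + lam * ‖x - xs‖, x)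
      + lam * ((x i - xs i) / ‖x - xs‖) * pdT F (ts + lam * ‖x - xs‖, x) := by
  obtain ⟨N, hN, hNi⟩ := pd_norm xs x hx
  have hc := ((hN.const_mul lam).const_add ts).prodMk (hasFDerivAt_id (𝕜 := ℝ) x)
  have h : HasFDerivAt (fun y => F (ts + lam * ‖y - xs‖, y)) _ x :=
    HasFDerivAt.comp x (g := F) (hF _).hasFDerivAt hc
  refine ⟨h.differentiableAt, fun i => ?_⟩
  rw [pdX_eq i F hF, pdT_eq F hF, pd, h.fderiv]
  have : ((lam * ((x i - xs i) / ‖x - xs‖), EuclideanSpace.single i 1) : ℝ × EuclideanSpace ℝ (Fin n))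
    = (0, EuclideanSpace.single i 1) + (lam * ((x i - xs i) / ‖x - xs‖)) • (1, 0) := by
    ext <;> simp
  simp only [ContinuousLinearMap.comp_apply, ContinuousLinearMap.prod_apply,
    ContinuousLinearMap.smul_apply, hNi, smul_eq_mul, id_eq, ContinuousLinearMap.id_apply]
  rw [this, map_add, map_smul, smul_eq_mul]

lemma pd_unit {n : ℕ} (xs x : EuclideanSpace ℝ (Fin n)) (hx : x ≠ xs) (i : Fin n) :
    DifferentiableAt ℝ (fun y : EuclideanSpace ℝ (Fin n) => (y i - xs i) / ‖y - xs‖) x ∧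
    pd i (fun y => (y i - xs i) / ‖y - xs‖) x
      = 1 / ‖x - xs‖ - (x i - xs i) ^ 2 / ‖x - xs‖ ^ 3 := by
  have hr : ‖x - xs‖ ≠ 0 := norm_ne_zero_iff.2 (sub_ne_zero.2 hx)
  obtain ⟨N, hN, hNi⟩ := pd_norm xs x hx
  have h0 : HasFDerivAt (fun y : EuclideanSpace ℝ (Fin n) => y i - xs i)
      (EuclideanSpace.proj i : EuclideanSpace ℝ (Fin n) →L[ℝ] ℝ) x :=
    ((EuclideanSpace.proj i : EuclideanSpace ℝ (Fin n) →L[ℝ] ℝ).hasFDerivAt).sub_const _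
  have h := h0.mul ((hasDerivAt_inv hr).comp_hasFDerivAt x hN)
  refine ⟨h.differentiableAt, ?_⟩
  have h2 : fderiv ℝ (fun y : EuclideanSpace ℝ (Fin n) => (y i - xs i) / ‖y - xs‖) x = _ := h.fderiv
  rw [pd, h2]
  simp [hNi]
  field_simp
  ring

lemma pdT_contDiff {n : ℕ} (F : ℝ × EuclideanSpace ℝ (Fin n) → ℝ) (hF : ContDiff ℝ 2 F)
    (v : ℝ × EuclideanSpace ℝ (Fin n)) : Differentiable ℝ (fun p => fderiv ℝ F p v) := by
  have : ContDiff ℝ 1 (fderiv ℝ F) := hF.fderiv_right (by norm_num)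
  exact fun p => ((this.differentiable (by norm_num)) p).clm_apply (differentiableAt_const v)

lemma mixed {n : ℕ} (F : ℝ × EuclideanSpace ℝ (Fin n) → ℝ) (hF : ContDiff ℝ 2 F)
    (v w p : ℝ × EuclideanSpace ℝ (Fin n)) :
    fderiv ℝ (fun p => fderiv ℝ F p v) p w = fderiv ℝ (fun p => fderiv ℝ F p w) p v := by
  have h1 : ContDiff ℝ 1 (fderiv ℝ F) := hF.fderiv_right (by norm_num)
  have hd := h1.differentiable (by norm_num) p
  rw [fderiv_clm_apply hd (differentiableAt_const v), fderiv_clm_apply hd (differentiableAt_const w)]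
  have hs : IsSymmSndFDerivAt ℝ F p := hF.contDiffAt.isSymmSndFDerivAt (by simp)
  simpa using hs.eq w v

/-- the first (asymmetric) differential tautology for a pair of biased
functional forms. -/
theorem stmt_3 (n : ℕ) (hn : 1 ≤ n) (lam : ℝ) (hlam : lam = -1 ∨ lam = 1)
    (ts : ℝ) (xs : EuclideanSpace ℝ (Fin n))
    (φ ψ : ℝ × EuclideanSpace ℝ (Fin n) → ℝ)
    (hφ : ContDiff ℝ 2 φ) (hψ : ContDiff ℝ 2 ψ)
    (x : EuclideanSpace ℝ (Fin n)) (hx : x ≠ xs) :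
    (fun y => φ (ts + lam * ‖y - xs‖, y)) x * dAlem ψ (ts + lam * ‖x - xs‖, x)
    - (lam / ‖x - xs‖) *
        (((n : ℝ) - 1) * (fun y => φ (ts + lam * ‖y - xs‖, y)) x
          + 2 * ∑ i : Fin n, (x i - xs i) *
              pd i (fun y => φ (ts + lam * ‖y - xs‖, y)) x) *
        pdT ψ (ts + lam * ‖x - xs‖, x)
    + (∑ i : Fin n, pd i (fun y => φ (ts + lam * ‖y - xs‖, y)) x *
        pd i (fun y => ψ (ts + lam * ‖y - xs‖, y)) x)
    - (∑ i : Fin n, pd i (fun y =>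
        φ (ts + lam * ‖y - xs‖, y) *
          (pdX i ψ (ts + lam * ‖y - xs‖, y)
            - lam * ((y i - xs i) / ‖y - xs‖) * pdT ψ (ts + lam * ‖y - xs‖, y))) x)
    = 0 := by
  have hr : ‖x - xs‖ ≠ 0 := norm_ne_zero_iff.2 (sub_ne_zero.2 hx)
  have hl : lam ^ 2 = 1 := by rcases hlam with h | h <;> simp [h]
  have hφd := hφ.differentiable (by norm_num)
  have hψd := hψ.differentiable (by norm_num)
  have eT : pdT ψ = fun p => fderiv ℝ ψ p (1, 0) := funext (pdT_eq ψ hψd)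
  have eX : ∀ i, pdX i ψ = fun p => fderiv ℝ ψ p (0, EuclideanSpace.single i 1) :=
    fun i => funext (pdX_eq i ψ hψd)
  have dT : Differentiable ℝ (pdT ψ) := by rw [eT]; exact pdT_contDiff ψ hψ _
  have dX : ∀ i, Differentiable ℝ (pdX i ψ) := by
    intro i; rw [eX]; exact pdT_contDiff ψ hψ _
  have hmix : ∀ i p, pdX i (pdT ψ) p = pdT (pdX i ψ) p := by
    intro i p
    rw [pdX_eq i _ dT, pdT_eq _ (dX i), eT, eX]
    exact mixed ψ hψ _ _ _
  obtain ⟨c1, c2⟩ := pd_cone lam ts xs x hx φ hφd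
  obtain ⟨-, c3⟩ := pd_cone lam ts xs x hx ψ hψd
  obtain ⟨t1, t2⟩ := pd_cone lam ts xs x hx _ dT
  have hL : ∀ i, pd i (fun y =>
        φ (ts + lam * ‖y - xs‖, y) *
          (pdX i ψ (ts + lam * ‖y - xs‖, y)
            - lam * ((y i - xs i) / ‖y - xs‖) * pdT ψ (ts + lam * ‖y - xs‖, y))) x
      = pd i (fun y => φ (ts + lam * ‖y - xs‖, y)) x * (pdX i ψ (ts + lam * ‖x - xs‖, x)
            - lam * ((x i - xs i) / ‖x - xs‖) * pdT ψ (ts + lam * ‖x - xs‖, x))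
        + φ (ts + lam * ‖x - xs‖, x) * (pdX i (pdX i ψ) (ts + lam * ‖x - xs‖, x)
          - lam * (1 / ‖x - xs‖ - (x i - xs i) ^ 2 / ‖x - xs‖ ^ 3)
              * pdT ψ (ts + lam * ‖x - xs‖, x)
          - ((x i - xs i) ^ 2 / ‖x - xs‖ ^ 2) * pdT (pdT ψ) (ts + lam * ‖x - xs‖, x)) := by
    intro i
    obtain ⟨u1, u2⟩ := pd_unit xs x hx i
    obtain ⟨v1, v2⟩ := pd_cone lam ts xs x hx _ (dX i)
    have key := c1.hasFDerivAt.mul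
      (v1.hasFDerivAt.sub ((u1.hasFDerivAt.const_mul lam).mul t1.hasFDerivAt))
    have k2 : fderiv ℝ (fun y =>
        φ (ts + lam * ‖y - xs‖, y) *
          (pdX i ψ (ts + lam * ‖y - xs‖, y)
            - lam * ((y i - xs i) / ‖y - xs‖) * pdT ψ (ts + lam * ‖y - xs‖, y))) x = _ :=
      key.fderiv
    have t3 := t2 i
    rw [hmix] at t3
    unfold pd at u2 v2 t3 ⊢
    rw [k2]
    simp only [ContinuousLinearMap.add_apply, ContinuousLinearMap.sub_apply,
      ContinuousLinearMap.smul_apply, smul_eq_mul, u2, v2, t3, Pi.sub_apply, Pi.mul_apply]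
    have hl' : lam * lam = 1 := by rw [← sq, hl]
    field_simp
    ring_nf
    simp only [hl]
    ring
  simp only [hL, dAlem]
  have hsum : ∑ i, (x i - xs i) ^ 2 = ‖x - xs‖ ^ 2 := by
    rw [EuclideanSpace.norm_sq_eq]; simp
  set r := ‖x - xs‖ with hrdef
  set p : ℝ × EuclideanSpace ℝ (Fin n) := (ts + lam * r, x)
  have e1 : ∀ i, pd i (fun y => ψ (ts + lam * ‖y - xs‖, y)) x
     = pdX i ψ p + lam * ((x i - xs i) / r) * pdT ψ p := c3
  simp only [e1]
  generalize hA : (fun i => pd i (fun y => φ (ts + lam * ‖y - xs‖, y)) x) = A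
  have hA' : ∀ i, pd i (fun y => φ (ts + lam * ‖y - xs‖, y)) x = A i := fun i => congrFun hA i
  simp only [hA']
  have s1 : ∑ i, A i * (pdX i ψ p + lam * ((x i - xs i) / r) * pdT ψ p)
      = ∑ i, A i * pdX i ψ p + lam / r * pdT ψ p * ∑ i, (x i - xs i) * A i := by
    rw [Finset.mul_sum, ← Finset.sum_add_distrib]
    exact Finset.sum_congr rfl fun i _ => by ring
  have s2 : ∑ i, (A i * (pdX i ψ p - lam * ((x i - xs i) / r) * pdT ψ p)
        + φ p * (pdX i (pdX i ψ) p - lam * (1 / r - (x i - xs i) ^ 2 / r ^ 3) * pdT ψ p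
          - ((x i - xs i) ^ 2 / r ^ 2) * pdT (pdT ψ) p))
      = ∑ i, A i * pdX i ψ p - lam / r * pdT ψ p * ∑ i, (x i - xs i) * A i
        + φ p * ∑ i, pdX i (pdX i ψ) p - φ p * lam * (1 / r) * pdT ψ p * ∑ i : Fin n, 1
        + (φ p * lam / r ^ 3 * pdT ψ p - φ p / r ^ 2 * pdT (pdT ψ) p)
          * ∑ i, (x i - xs i) ^ 2 := by
    simp only [Finset.mul_sum, ← Finset.sum_add_distrib, ← Finset.sum_sub_distrib]
    exact Finset.sum_congr rfl fun i _ => by ring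
  rw [s1, s2, hsum]
  simp only [Finset.sum_const, Finset.card_univ, Fintype.card_fin, nsmul_eq_mul, mul_one]
  field_simp
  ring
end

section
/- Let λ ∈ {−1, 1}, t* ∈ ℝ, x* ∈ E³, and let ψ : ℝ × E³ → ℝ be twice continuously differentiable and satisfy the decay condition at (t*, x*, λ). Then the function x ↦ (□ψ)(t* + λ‖x − x*‖, x)/‖x − x*‖ is Lebesgue integrable on E³ and ψ(t*, x*) = −(1/(4π))·∫_{E³} (□ψ)(t* + λ‖x − x*‖, x)/‖x − x*‖ dx. (For λ = −1 this is the retarded, for λ = 1 the advanced, non-dispersive forced solution formula of the inhomogeneous wave equation □ψ = −f in three-dimensional space: ψ(t*, x*) = (1/4π)∫ f(t* + λ‖x − x*‖, x)/‖x − x*‖ dx.) -/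
open MeasureTheory Real Filter

/-- The decay condition of ψ at (t*, x*, λ): beyond some radius r*, for each m ∈ {0,1,2}
there are p_m > m and C_m > 0 bounding every pure m-th order partial derivative of ψ
(with respect to the time variable or a single space coordinate), evaluated along the
biased argument, by C_m * ‖x - x*‖ ^ (-p_m). -/
def Decay {n : ℕ} (ψ : ℝ × EuclideanSpace ℝ (Fin n) → ℝ) (ts lam : ℝ)
    (xs : EuclideanSpace ℝ (Fin n)) : Prop :=
  ∃ rs : ℝ, 0 < rs ∧
    (∃ p C : ℝ, 0 < p ∧ 0 < C ∧ ∀ x, rs < ‖x - xs‖ →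
      |ψ (ts + lam * ‖x - xs‖, x)| ≤ C * ‖x - xs‖ ^ (-p)) ∧
    (∃ p C : ℝ, 1 < p ∧ 0 < C ∧ ∀ x, rs < ‖x - xs‖ →
      |pdT ψ (ts + lam * ‖x - xs‖, x)| ≤ C * ‖x - xs‖ ^ (-p) ∧
      ∀ i, |pdX i ψ (ts + lam * ‖x - xs‖, x)| ≤ C * ‖x - xs‖ ^ (-p)) ∧
    (∃ p C : ℝ, 2 < p ∧ 0 < C ∧ ∀ x, rs < ‖x - xs‖ →
      |pdT (pdT ψ) (ts + lam * ‖x - xs‖, x)| ≤ C * ‖x - xs‖ ^ (-p) ∧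
      ∀ i, |pdX i (pdX i ψ) (ts + lam * ‖x - xs‖, x)| ≤ C * ‖x - xs‖ ^ (-p))

abbrev E3 := EuclideanSpace ℝ (Fin 3)

noncomputable abbrev ee (i : Fin 3) : E3 := EuclideanSpace.single i 1

lemma pdT_eq_s16 {f : ℝ × E3 → ℝ} (hf : Differentiable ℝ f) :
    pdT f = fun p => fderiv ℝ f p (1, 0) := by
  funext p
  unfold pdT
  have h1 : HasDerivAt (fun s : ℝ => ((s, p.2) : ℝ × E3)) (1, 0) p.1 :=
    (hasDerivAt_id p.1).prodMk (hasDerivAt_const p.1 p.2)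
  exact ((hf p).hasFDerivAt.comp_hasDerivAt p.1 h1).deriv

lemma pdX_eq_s16 {f : ℝ × E3 → ℝ} (hf : Differentiable ℝ f) (i : Fin 3) :
    pdX i f = fun p => fderiv ℝ f p (0, ee i) := by
  funext p
  unfold pdX
  have h1 : HasFDerivAt (fun y : E3 => ((p.1, y) : ℝ × E3)) (ContinuousLinearMap.inr ℝ ℝ E3) p.2 :=
    hasFDerivAt_prodMk_right p.1 p.2
  have h2 := ((hf p).hasFDerivAt.comp p.2 h1).fderiv
  simp only [Function.comp_def] at h2
  rw [h2]
  simp [ee]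

lemma line_norm {y : E3} (hy : y ≠ 0) (i : Fin 3) :
    HasDerivAt (fun s : ℝ => ‖y + s • ee i‖) (y i / ‖y‖) 0 := by
  have h1 : HasDerivAt (fun s : ℝ => y + s • ee i) (ee i) 0 := by
    simpa using ((hasDerivAt_id (0:ℝ)).smul_const (ee i)).const_add y
  have h2 := h1.norm_sq
  have h3 := h2.sqrt (by simpa using hy)
  have h4 : (fun s : ℝ => ‖y + s • ee i‖) = fun s => √(‖y + s • ee i‖ ^ 2) := by
    funext s; rw [Real.sqrt_sq (norm_nonneg _)]
  rw [h4]
  convert h3 using 1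
  have : ‖y‖ ≠ 0 := norm_ne_zero_iff.mpr hy
  simp [ee, EuclideanSpace.inner_single_right]
  field_simp

lemma line_br {f : ℝ × E3 → ℝ} (hf : Differentiable ℝ f) (ts lam : ℝ) (xs : E3)
    {y : E3} (hy : y ≠ 0) (i : Fin 3) :
    HasDerivAt (fun s : ℝ => f (ts + lam * ‖y + s • ee i‖, (y + s • ee i) + xs))
      (fderiv ℝ f (ts + lam * ‖y‖, y + xs) (0, ee i) +
        lam * (y i / ‖y‖) * fderiv ℝ f (ts + lam * ‖y‖, y + xs) (1, 0)) 0 := by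
  have h1 : HasDerivAt (fun s : ℝ => (y + s • ee i) + xs) (ee i) 0 := by
    simpa using (((hasDerivAt_id (0:ℝ)).smul_const (ee i)).const_add y).add_const xs
  have h2 := ((line_norm hy i).const_mul lam).const_add ts
  have h3 := h2.prodMk h1
  have h4 := ((hf (ts + lam * ‖y + (0:ℝ) • ee i‖, (y + (0:ℝ) • ee i) + xs)).hasFDerivAt.comp_hasDerivAt
    (0:ℝ) h3)
  simp only [zero_smul, add_zero] at h4
  refine h4.congr_deriv ?_
  have : ((lam * (y i / ‖y‖), ee i) : ℝ × E3) = (0, ee i) + (lam * (y i / ‖y‖)) • (1, 0) := by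
    ext <;> simp
  rw [this, map_add, map_smul, smul_eq_mul]

lemma line_coord (y : E3) (i : Fin 3) :
    HasDerivAt (fun s : ℝ => (y + s • ee i) i) 1 0 := by
  simpa [ee] using (hasDerivAt_id (0:ℝ)).const_add (y i)

/-- the vector field -/
noncomputable def VV (ψ : ℝ × E3 → ℝ) (ts lam : ℝ) (xs : E3) (i : Fin 3) (y : E3) : ℝ :=
  fderiv ℝ ψ (ts + lam * ‖y‖, y + xs) (0, ee i) / ‖y‖ +
   y i * (-lam * fderiv ℝ ψ (ts + lam * ‖y‖, y + xs) (1, 0) / ‖y‖ ^ 2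
     + ψ (ts + lam * ‖y‖, y + xs) / ‖y‖ ^ 3)

noncomputable def GG (ψ : ℝ × E3 → ℝ) (ts lam : ℝ) (xs : E3) (y : E3) : ℝ :=
  (∑ i, y i * fderiv ℝ ψ (ts + lam * ‖y‖, y + xs) (0, ee i))
   - lam * ‖y‖ * fderiv ℝ ψ (ts + lam * ‖y‖, y + xs) (1, 0) + ψ (ts + lam * ‖y‖, y + xs)

noncomputable def BB (ψ : ℝ × E3 → ℝ) (ts lam : ℝ) (xs : E3) (y : E3) : ℝ :=
  dAlem ψ (ts + lam * ‖y‖, y + xs)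

lemma contDiff_D {ψ : ℝ × E3 → ℝ} (hψ : ContDiff ℝ 2 ψ) (v : ℝ × E3) :
    ContDiff ℝ 1 (fun p => fderiv ℝ ψ p v) :=
  (hψ.fderiv_right (m := 1) (by norm_num)).clm_apply contDiff_const

lemma mixed_s16 {ψ : ℝ × E3 → ℝ} (hψ : ContDiff ℝ 2 ψ) (u v p : ℝ × E3) :
    fderiv ℝ (fun p => fderiv ℝ ψ p u) p v = fderiv ℝ (fun p => fderiv ℝ ψ p v) p u := by
  have hd : Differentiable ℝ (fderiv ℝ ψ) :=
    (hψ.fderiv_right (m := 1) (by norm_num)).differentiable (by norm_num)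
  have h (u v : ℝ × E3) : fderiv ℝ (fun p => fderiv ℝ ψ p u) p v = fderiv ℝ (fderiv ℝ ψ) p v u := by
    rw [fderiv_clm_apply (hd p) (by fun_prop)]
    simp
  rw [h, h]
  exact (hψ.contDiffAt.isSymmSndFDerivAt (by simp)) v u

lemma BB_eq {ψ : ℝ × E3 → ℝ} (hψ : ContDiff ℝ 2 ψ) (p : ℝ × E3) :
    dAlem ψ p = (∑ i, fderiv ℝ (fun p => fderiv ℝ ψ p (0, ee i)) p (0, ee i))
      - fderiv ℝ (fun p => fderiv ℝ ψ p (1, 0)) p (1, 0) := by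
  have h0 : Differentiable ℝ ψ := hψ.differentiable (by norm_num)
  unfold dAlem
  rw [pdT_eq_s16 h0, pdT_eq_s16 ((contDiff_D hψ _).differentiable (by norm_num))]
  congr 1
  refine Finset.sum_congr rfl fun i _ => ?_
  rw [pdX_eq_s16 h0, pdX_eq_s16 ((contDiff_D hψ _).differentiable (by norm_num))]

lemma div_W {ψ : ℝ × E3 → ℝ} (hψ : ContDiff ℝ 2 ψ) (ts lam : ℝ) (hl : lam = -1 ∨ lam = 1) (xs : E3)
    {c : ℝ → ℝ} (hc : Differentiable ℝ c) {y : E3} (hy : y ≠ 0)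
    (hW : ∀ i, DifferentiableAt ℝ (fun y : E3 => c ‖y‖ * VV ψ ts lam xs i y) y) :
    ∑ i, fderiv ℝ (fun y : E3 => c ‖y‖ * VV ψ ts lam xs i y) y (ee i)
      = c ‖y‖ * (BB ψ ts lam xs y / ‖y‖) + deriv c ‖y‖ / ‖y‖ ^ 2 * GG ψ ts lam xs y := by
  have hr : ‖y‖ ≠ 0 := norm_ne_zero_iff.mpr hy
  have h0 : Differentiable ℝ ψ := hψ.differentiable (by norm_num)
  have hD (v) := (contDiff_D hψ v).differentiable (by norm_num)
  have key (i : Fin 3) :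
      fderiv ℝ (fun y : E3 => c ‖y‖ * VV ψ ts lam xs i y) y (ee i) =
      c ‖y‖ * (fderiv ℝ (fun p => fderiv ℝ ψ p (0, ee i)) (ts + lam * ‖y‖, y + xs) (0, ee i) / ‖y‖
        + (-lam * fderiv ℝ ψ (ts + lam * ‖y‖, y + xs) (1, 0) / ‖y‖ ^ 2
          + ψ (ts + lam * ‖y‖, y + xs) / ‖y‖ ^ 3)
        + y i ^ 2 * (- fderiv ℝ (fun p => fderiv ℝ ψ p (1, 0)) (ts + lam * ‖y‖, y + xs) (1, 0) / ‖y‖ ^ 3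
          + 3 * lam * fderiv ℝ ψ (ts + lam * ‖y‖, y + xs) (1, 0) / ‖y‖ ^ 4
          - 3 * ψ (ts + lam * ‖y‖, y + xs) / ‖y‖ ^ 5))
      + deriv c ‖y‖ * (y i * fderiv ℝ ψ (ts + lam * ‖y‖, y + xs) (0, ee i) / ‖y‖ ^ 2
        + y i ^ 2 * (-lam * fderiv ℝ ψ (ts + lam * ‖y‖, y + xs) (1, 0) / ‖y‖ ^ 3
          + ψ (ts + lam * ‖y‖, y + xs) / ‖y‖ ^ 4)) := by
    have a1 := line_norm hy i
    have hz : y + (0:ℝ) • ee i = y := by simp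
    have hrz : ‖y + (0:ℝ) • ee i‖ ≠ 0 := by rw [hz]; exact hr
    have ac : HasDerivAt (fun s : ℝ => c ‖y + s • ee i‖) (deriv c ‖y‖ * (y i / ‖y‖)) 0 := by
      have := (hc ‖y + (0:ℝ) • ee i‖).hasDerivAt.comp (0:ℝ) a1
      rwa [hz] at this
    have aP := line_br (hD (0, ee i)) ts lam xs hy i
    have aT := line_br (hD (1, 0)) ts lam xs hy i
    have a0 := line_br h0 ts lam xs hy i
    have ax := line_coord y i
    have H := ac.mul ((aP.div a1 hrz).add (ax.mul
      (((aT.const_mul (-lam)).div (a1.pow 2) (pow_ne_zero 2 hrz)).add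
        (a0.div (a1.pow 3) (pow_ne_zero 3 hrz)))))
    have L := ((hW i).hasFDerivAt.hasLineDerivAt (ee i))
    refine (HasDerivAt.unique L H).trans ?_
    simp only [Pi.add_apply, Pi.mul_apply, Pi.div_apply, Pi.pow_apply, hz, 
      mixed_s16 hψ (0, ee i) (1, 0)]
    generalize fderiv ℝ ψ (ts + lam * ‖y‖, y + xs) (0, ee i) = P
    generalize fderiv ℝ ψ (ts + lam * ‖y‖, y + xs) (1, 0) = T
    generalize ψ (ts + lam * ‖y‖, y + xs) = Q
    generalize fderiv ℝ (fun p => fderiv ℝ ψ p (0, ee i)) (ts + lam * ‖y‖, y + xs) (0, ee i) = A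
    generalize fderiv ℝ (fun p => fderiv ℝ ψ p (1, 0)) (ts + lam * ‖y‖, y + xs) (0, ee i) = B
    generalize fderiv ℝ (fun p => fderiv ℝ ψ p (1, 0)) (ts + lam * ‖y‖, y + xs) (1, 0) = C
    generalize y i = Y
    generalize c ‖y‖ = c0
    generalize deriv c ‖y‖ = c1
    generalize ‖y‖ = r at hr
    push_cast
    rcases hl with rfl | rfl <;> field_simp <;> ring
  have hn : ‖y‖ ^ 2 = y 0 ^ 2 + y 1 ^ 2 + y 2 ^ 2 := by
    rw [EuclideanSpace.real_norm_sq_eq, Fin.sum_univ_three]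
  simp only [key]
  simp only [BB, GG, BB_eq hψ, Fin.sum_univ_three]
  generalize fderiv ℝ ψ (ts + lam * ‖y‖, y + xs) (0, ee 0) = P0
  generalize fderiv ℝ ψ (ts + lam * ‖y‖, y + xs) (0, ee 1) = P1
  generalize fderiv ℝ ψ (ts + lam * ‖y‖, y + xs) (0, ee 2) = P2
  generalize fderiv ℝ ψ (ts + lam * ‖y‖, y + xs) (1, 0) = T
  generalize ψ (ts + lam * ‖y‖, y + xs) = Q
  generalize fderiv ℝ (fun p => fderiv ℝ ψ p (0, ee 0)) (ts + lam * ‖y‖, y + xs) (0, ee 0) = A0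
  generalize fderiv ℝ (fun p => fderiv ℝ ψ p (0, ee 1)) (ts + lam * ‖y‖, y + xs) (0, ee 1) = A1
  generalize fderiv ℝ (fun p => fderiv ℝ ψ p (0, ee 2)) (ts + lam * ‖y‖, y + xs) (0, ee 2) = A2
  generalize fderiv ℝ (fun p => fderiv ℝ ψ p (1, 0)) (ts + lam * ‖y‖, y + xs) (1, 0) = C
  generalize c ‖y‖ = c0
  generalize deriv c ‖y‖ = c1
  generalize y 0 = Y0 at *
  generalize y 1 = Y1 at *
  generalize y 2 = Y2 at *
  generalize ‖y‖ = r at *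
  have e : Y0 ^ 2 = r ^ 2 - Y1 ^ 2 - Y2 ^ 2 := by linarith
  rw [e]
  field_simp
  ring

lemma cd_br {f : ℝ × E3 → ℝ} (hf : ContDiff ℝ 1 f) (ts lam : ℝ) (xs : E3)
    {y : E3} (hy : y ≠ 0) : ContDiffAt ℝ 1 (fun y : E3 => f (ts + lam * ‖y‖, y + xs)) y := by
  refine hf.contDiffAt.comp y (ContDiffAt.prodMk ?_ (by fun_prop))
  exact contDiffAt_const.add (contDiffAt_const.mul (contDiffAt_norm ℝ hy))

lemma cd_VV {ψ : ℝ × E3 → ℝ} (hψ : ContDiff ℝ 2 ψ) (ts lam : ℝ) (xs : E3) (i : Fin 3)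
    {y : E3} (hy : y ≠ 0) : ContDiffAt ℝ 1 (VV ψ ts lam xs i) y := by
  have hr : ‖y‖ ≠ 0 := norm_ne_zero_iff.mpr hy
  have hN : ContDiffAt ℝ 1 (fun y : E3 => ‖y‖) y := contDiffAt_norm ℝ hy
  have h1 := cd_br (contDiff_D hψ (0, ee i)) ts lam xs hy
  have h2 := cd_br (contDiff_D hψ (1, 0)) ts lam xs hy
  have h3 := cd_br (hψ.of_le (by norm_num)) ts lam xs hy
  have h4 : ContDiffAt ℝ 1 (fun y : E3 => y i) y := by fun_prop
  unfold VV
  exact (h1.div hN hr).add (h4.mul (((contDiffAt_const.mul h2).div (hN.pow 2) (pow_ne_zero 2 hr)).add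
    (h3.div (hN.pow 3) (pow_ne_zero 3 hr))))

lemma cd_W {ψ : ℝ × E3 → ℝ} (hψ : ContDiff ℝ 2 ψ) (ts lam : ℝ) (xs : E3) (i : Fin 3)
    {c : ℝ → ℝ} (hc : ContDiff ℝ 1 c) {a : ℝ} (ha : 0 < a) (hca : ∀ r < a, c r = 0) :
    ContDiff ℝ 1 (fun y : E3 => c ‖y‖ * VV ψ ts lam xs i y) := by
  rw [contDiff_iff_contDiffAt]
  intro y
  by_cases hy : y = 0
  · subst hy
    refine (contDiffAt_const (c := (0:ℝ))).congr_of_eventuallyEq ?_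
    filter_upwards [Metric.ball_mem_nhds (0:E3) ha] with z hz
    rw [hca _ (by simpa using hz), zero_mul]
  · exact (hc.contDiffAt.comp y (contDiffAt_norm ℝ hy)).mul (cd_VV hψ ts lam xs i hy)

lemma int_fderiv_zero {W : E3 → ℝ} (hW : ContDiff ℝ 1 W) (hs : HasCompactSupport W) (v : E3) :
    Integrable (fun y => fderiv ℝ W y v) ∧ ∫ y, fderiv ℝ W y v = 0 := by
  have h1 : Integrable (fun y => fderiv ℝ W y v) :=
    ((hW.continuous_fderiv (by norm_num)).clm_apply continuous_const).integrable_of_hasCompactSupport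
      (hs.fderiv_apply ℝ v)
  refine ⟨h1, ?_⟩
  have := integral_mul_fderiv_eq_neg_fderiv_mul_of_integrable (μ := (volume : Measure E3))
    (f := fun _ => (1:ℝ)) (g := W) (v := v) (by simp) (by simpa using h1)
    (by simpa using hW.continuous.integrable_of_hasCompactSupport hs)
    (by intros; fun_prop) (fun x _ => hW.differentiable (by norm_num) x)
  simpa using this

lemma main_id {ψ : ℝ × E3 → ℝ} (hψ : ContDiff ℝ 2 ψ) (ts lam : ℝ) (hl : lam = -1 ∨ lam = 1) (xs : E3)
    {c : ℝ → ℝ} (hc : ContDiff ℝ 1 c) {a b : ℝ} (ha : 0 < a) (hca : ∀ r < a, c r = 0)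
    (hcb : ∀ r > b, c r = 0) :
    ∫ y : E3, (c ‖y‖ * (BB ψ ts lam xs y / ‖y‖) + deriv c ‖y‖ / ‖y‖ ^ 2 * GG ψ ts lam xs y) = 0 := by
  have hW (i) := cd_W hψ ts lam xs i hc ha hca
  have hs (i) : HasCompactSupport (fun y : E3 => c ‖y‖ * VV ψ ts lam xs i y) := by
    refine HasCompactSupport.intro (isCompact_closedBall (0:E3) b) fun y hy => ?_
    rw [hcb _ (by simpa using hy), zero_mul]
  have h1 : ∫ y : E3, ∑ i, fderiv ℝ (fun y : E3 => c ‖y‖ * VV ψ ts lam xs i y) y (ee i) = 0 := by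
    rw [integral_finsetSum _ fun i _ => (int_fderiv_zero (hW i) (hs i) (ee i)).1]
    exact Finset.sum_eq_zero fun i _ => (int_fderiv_zero (hW i) (hs i) (ee i)).2
  rw [← h1]
  refine integral_congr_ae ?_
  have : ∀ᵐ y : E3, y ≠ 0 := by simp [ae_iff]
  filter_upwards [this] with y hy
  exact (div_W hψ ts lam hl xs (hc.differentiable (by norm_num)) hy
    fun i => (hW i).differentiable (by norm_num) y).symm

noncomputable def th (s : ℝ) : ℝ := Real.smoothTransition (s - 1)

lemma th_cd : ContDiff ℝ 1 th :=
  (Real.smoothTransition.contDiff (n := 1)).comp (contDiff_id.sub contDiff_const)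

lemma th_zero {s : ℝ} (h : s ≤ 1) : th s = 0 :=
  Real.smoothTransition.zero_of_nonpos (by linarith)

lemma th_one {s : ℝ} (h : 2 ≤ s) : th s = 1 :=
  Real.smoothTransition.one_of_one_le (by linarith)

lemma dth_zero {s : ℝ} (h : s < 1) : deriv th s = 0 := by
  have : th =ᶠ[nhds s] fun _ => 0 := by
    filter_upwards [Iio_mem_nhds h] with x hx using th_zero (le_of_lt hx)
  rw [this.deriv_eq]; simp

lemma dth_zero' {s : ℝ} (h : 2 < s) : deriv th s = 0 := by
  have : th =ᶠ[nhds s] fun _ => 1 := by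
    filter_upwards [Ioi_mem_nhds h] with x hx using th_one (le_of_lt hx)
  rw [this.deriv_eq]; simp

lemma dth_cont : Continuous (deriv th) := th_cd.continuous_deriv (by norm_num)

noncomputable def KK (s : ℝ) : ℝ := deriv th s / s ^ 2

lemma KK_cont : Continuous KK := by
  have : KK = fun s => deriv th s / (max s 1) ^ 2 := by
    funext s
    unfold KK
    by_cases h : s < 1
    · rw [dth_zero h]; simp
    · rw [max_eq_left (not_lt.mp h)]
  rw [this]
  refine dth_cont.div (by fun_prop) fun s => ?_
  have : (1:ℝ) ≤ max s 1 := le_max_right _ _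
  positivity

lemma KK_supp : HasCompactSupport (fun y : E3 => KK ‖y‖) := by
  refine HasCompactSupport.intro (isCompact_closedBall (0:E3) 2) fun y hy => ?_
  have : 2 < ‖y‖ := by simpa using hy
  simp [KK, dth_zero' this]

lemma KK_int : Integrable (fun y : E3 => KK ‖y‖) :=
  (KK_cont.comp continuous_norm).integrable_of_hasCompactSupport KK_supp

lemma KK_val : ∫ y : E3, KK ‖y‖ = 4 * Real.pi := by
  rw [integral_fun_norm_addHaar]
  have h1 : ∫ y in Set.Ioi (0:ℝ), y ^ (Module.finrank ℝ E3 - 1) • KK y = 1 := by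
    have h2 : ∫ y in Set.Ioi (0:ℝ), y ^ (Module.finrank ℝ E3 - 1) • KK y
        = ∫ y in Set.Ioi (0:ℝ), deriv th y := by
      refine setIntegral_congr_fun measurableSet_Ioi fun y hy => ?_
      have : y ≠ 0 := ne_of_gt hy
      simp [KK]
      field_simp
    rw [h2]
    have hi : Integrable (deriv th) := by
      refine dth_cont.integrable_of_hasCompactSupport ?_
      refine HasCompactSupport.intro (isCompact_Icc (a := (1:ℝ)) (b := 2)) fun y hy => ?_
      by_cases h : y < 1
      · exact dth_zero h
      · refine dth_zero' ?_
        by_contra h'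
        exact hy ⟨not_lt.mp h, not_lt.mp h'⟩
    have := integral_Ioi_of_hasDerivAt_of_tendsto' (a := 0) (f := th) (f' := deriv th) (m := 1)
      (fun x _ => (th_cd.differentiable (by norm_num) x).hasDerivAt) hi.integrableOn
      (tendsto_const_nhds.congr' (by
        filter_upwards [eventually_ge_atTop 2] with x hx using (th_one hx).symm))
    rw [this, th_zero (by norm_num)]; simp
  rw [h1]
  simp [Measure.real, EuclideanSpace.volume_ball_fin_three]
  rw [ENNReal.toReal_ofReal (by positivity)]
  ring

lemma bdd_of_tendsto {G : E3 → ℝ} (hG : Continuous G) (h0 : Tendsto G (cocompact E3) (nhds 0)) :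
    ∃ M, ∀ y, |G y| ≤ M := by
  have h1 : ∀ᶠ y in cocompact E3, |G y| < 1 := by
    have := h0.abs
    rw [abs_zero] at this
    exact this.eventually (gt_mem_nhds one_pos)
  obtain ⟨t, ht, hts⟩ := mem_cocompact.mp h1
  obtain ⟨C, hC⟩ := ht.exists_bound_of_continuousOn hG.continuousOn
  refine ⟨max C 1, fun y => ?_⟩
  by_cases hy : y ∈ t
  · exact (hC y hy).trans (le_max_left _ _)
  · exact (le_of_lt (hts hy)).trans (le_max_right _ _)

lemma II_lim {G : E3 → ℝ} (hG : Continuous G) (h0 : Tendsto G (cocompact E3) (nhds 0))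
    (b : ℕ → ℝ) (L : ℝ) (hb : ∀ y : E3, y ≠ 0 → Tendsto (fun k => G (b k • y)) atTop (nhds L)) :
    Tendsto (fun k => ∫ y : E3, KK ‖y‖ * G (b k • y)) atTop (nhds (4 * Real.pi * L)) := by
  obtain ⟨M, hM⟩ := bdd_of_tendsto hG h0
  have e : 4 * Real.pi * L = ∫ y : E3, KK ‖y‖ * L := by
    rw [integral_mul_const, KK_val]
  rw [e]
  have hne : ∀ᵐ y : E3, y ≠ 0 := by simp [ae_iff]
  refine tendsto_integral_of_dominated_convergence (fun y => |KK ‖y‖| * M) ?_ ?_ ?_ ?_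
  · intro k
    have h1 := KK_cont.comp (continuous_norm (E := E3))
    exact (h1.mul (hG.comp (by fun_prop))).aestronglyMeasurable
  · exact KK_int.abs.mul_const M
  · intro k
    filter_upwards with y
    rw [norm_mul, Real.norm_eq_abs, Real.norm_eq_abs]
    exact mul_le_mul_of_nonneg_left (hM _) (abs_nonneg _)
  · filter_upwards [hne] with y hy
    exact (hb y hy).const_mul _

lemma II_int {G : E3 → ℝ} (hG : Continuous G) (b : ℝ) :
    Integrable (fun y : E3 => KK ‖y‖ * G (b • y)) := by
  have h1 := KK_cont.comp (continuous_norm (E := E3))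
  exact (h1.mul (hG.comp (by fun_prop))).integrable_of_hasCompactSupport KK_supp.mul_right

lemma II_scale {G : E3 → ℝ} (hG : Continuous G) {b : ℝ} (hb : 0 < b) :
    Integrable (fun y : E3 => b ^ 3 * KK (b * ‖y‖) * G y) ∧
    ∫ y : E3, b ^ 3 * KK (b * ‖y‖) * G y = ∫ y : E3, KK ‖y‖ * G (b⁻¹ • y) := by
  have e : (fun y : E3 => b ^ 3 * KK (b * ‖y‖) * G y)
      = fun y => b ^ 3 * (fun z : E3 => KK ‖z‖ * G (b⁻¹ • z)) (b • y) := by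
    funext y
    simp only [norm_smul, Real.norm_eq_abs, abs_of_pos hb, smul_smul, inv_mul_cancel₀ hb.ne', one_smul]
    ring
  constructor
  · rw [e]
    exact ((integrable_comp_smul_iff volume _ hb.ne').mpr (II_int hG b⁻¹)).const_mul _
  · rw [e, integral_const_mul,
      Measure.integral_comp_smul volume (fun z : E3 => KK ‖z‖ * G (b⁻¹ • z)) b]
    have : Module.finrank ℝ E3 = 3 := by simp
    rw [this, abs_of_pos (by positivity), smul_eq_mul, ← mul_assoc, mul_inv_cancel₀ (by positivity), one_mul]

noncomputable def cc (a r : ℝ) : ℝ := th (a * r) - th (a⁻¹ * r)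

lemma cc_cd (a : ℝ) : ContDiff ℝ 1 (cc a) :=
  (th_cd.comp (contDiff_const.mul contDiff_id)).sub (th_cd.comp (contDiff_const.mul contDiff_id))

lemma cc_deriv (a r : ℝ) : deriv (cc a) r = a * deriv th (a * r) - a⁻¹ * deriv th (a⁻¹ * r) := by
  have h (b : ℝ) : HasDerivAt (fun r => th (b * r)) (b * deriv th (b * r)) r := by
    have h1 := (th_cd.differentiable (by norm_num) (b * r)).hasDerivAt.comp r
      ((hasDerivAt_id r).const_mul b)
    simpa [mul_comm, Function.comp_def] using h1
  exact ((h a).sub (h a⁻¹)).deriv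

lemma cc_div {a r : ℝ} (ha : 0 < a) (hr : r ≠ 0) :
    deriv (cc a) r / r ^ 2 = a ^ 3 * KK (a * r) - a⁻¹ ^ 3 * KK (a⁻¹ * r) := by
  rw [cc_deriv]; unfold KK
  field_simp

lemma cc_abs (a r : ℝ) : |cc a r| ≤ 1 := by
  have h (s) : 0 ≤ th s ∧ th s ≤ 1 :=
    ⟨Real.smoothTransition.nonneg _, Real.smoothTransition.le_one _⟩
  have h1 := h (a * r)
  have h2 := h (a⁻¹ * r)
  unfold cc
  rw [abs_le]; constructor <;> linarith

lemma cc_id {ψ : ℝ × E3 → ℝ} (hψ : ContDiff ℝ 2 ψ) (ts lam : ℝ) (hl : lam = -1 ∨ lam = 1) (xs : E3)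
    (hG : Continuous (GG ψ ts lam xs)) 
    (hF : Integrable (fun y : E3 => BB ψ ts lam xs y / ‖y‖)) {a : ℝ} (ha : 1 ≤ a) :
    ∫ y : E3, cc a ‖y‖ * (BB ψ ts lam xs y / ‖y‖) =
      (∫ y : E3, KK ‖y‖ * GG ψ ts lam xs (a • y)) - ∫ y : E3, KK ‖y‖ * GG ψ ts lam xs (a⁻¹ • y) := by
  have ha0 : 0 < a := by linarith
  have hai : a⁻¹ ≤ 1 := inv_le_one_of_one_le₀ ha
  have hz : ∀ r < a⁻¹, cc a r = 0 := by
    intro r hr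
    have h1 : a * r ≤ 1 := by
      calc a * r ≤ a * a⁻¹ := by gcongr
        _ = 1 := mul_inv_cancel₀ ha0.ne'
    have h2 : a⁻¹ * r ≤ 1 := by
      rw [inv_mul_le_iff₀ ha0]; linarith
    simp [cc, th_zero h1, th_zero h2]
  have hz' : ∀ r > 2 * a, cc a r = 0 := by
    intro r hr
    have h1 : 2 ≤ a * r := by nlinarith
    have h2 : 2 ≤ a⁻¹ * r := by
      rw [le_inv_mul_iff₀ ha0]; linarith
    simp [cc, th_one h1, th_one h2]
  have h := main_id hψ ts lam hl xs (cc_cd a) (inv_pos.mpr ha0) hz hz'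
  have s1 := II_scale hG ha0
  have s2 := II_scale hG (inv_pos.mpr ha0)
  have hne : ∀ᵐ y : E3, y ≠ 0 := by simp [ae_iff]
  have hc : Integrable (fun y : E3 => cc a ‖y‖ * (BB ψ ts lam xs y / ‖y‖)) := by
    refine hF.bdd_mul (c := 1) ((cc_cd a).continuous.comp continuous_norm).aestronglyMeasurable ?_
    filter_upwards with y using cc_abs _ _
  have e : ∫ y : E3, (cc a ‖y‖ * (BB ψ ts lam xs y / ‖y‖) + deriv (cc a) ‖y‖ / ‖y‖ ^ 2 * GG ψ ts lam xs y)
      = ∫ y : E3, (cc a ‖y‖ * (BB ψ ts lam xs y / ‖y‖) +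
        (a ^ 3 * KK (a * ‖y‖) * GG ψ ts lam xs y - a⁻¹ ^ 3 * KK (a⁻¹ * ‖y‖) * GG ψ ts lam xs y)) := by
    refine integral_congr_ae ?_
    filter_upwards [hne] with y hy
    rw [cc_div ha0 (norm_ne_zero_iff.mpr hy), sub_mul]
  have h12 : Integrable (fun y : E3 => a ^ 3 * KK (a * ‖y‖) * GG ψ ts lam xs y
      - a⁻¹ ^ 3 * KK (a⁻¹ * ‖y‖) * GG ψ ts lam xs y) := s1.1.sub s2.1
  rw [e, integral_add hc h12, integral_sub s1.1 s2.1, s1.2, s2.2, inv_inv] at h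
  linarith

lemma final_id {ψ : ℝ × E3 → ℝ} (hψ : ContDiff ℝ 2 ψ) (ts lam : ℝ) (hl : lam = -1 ∨ lam = 1) (xs : E3)
    (hG : Continuous (GG ψ ts lam xs)) (h0 : Tendsto (GG ψ ts lam xs) (cocompact E3) (nhds 0))
    (hF : Integrable (fun y : E3 => BB ψ ts lam xs y / ‖y‖)) :
    ∫ y : E3, BB ψ ts lam xs y / ‖y‖ = - (4 * Real.pi * ψ (ts, xs)) := by
  set a : ℕ → ℝ := fun k => (k:ℝ) + 1 with hadef
  have ha1 (k) : 1 ≤ a k := by simp [hadef]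
  have hat : Tendsto a atTop atTop :=
    tendsto_atTop_add_const_right _ _ tendsto_natCast_atTop_atTop
  have hait : Tendsto (fun k => (a k)⁻¹) atTop (nhds 0) := tendsto_inv_atTop_zero.comp hat
  have hne : ∀ᵐ y : E3, y ≠ 0 := by simp [ae_iff]
  have t1 : Tendsto (fun k => ∫ y : E3, cc (a k) ‖y‖ * (BB ψ ts lam xs y / ‖y‖)) atTop
      (nhds (∫ y : E3, BB ψ ts lam xs y / ‖y‖)) := by
    refine tendsto_integral_of_dominated_convergence (fun y => |BB ψ ts lam xs y / ‖y‖|) ?_ hF.abs ?_ ?_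
    · intro k
      exact (((cc_cd (a k)).continuous.comp continuous_norm).aestronglyMeasurable).mul
        hF.aestronglyMeasurable
    · intro k
      filter_upwards with y
      rw [norm_mul, Real.norm_eq_abs, Real.norm_eq_abs]
      exact mul_le_of_le_one_left (abs_nonneg _) (cc_abs _ _)
    · filter_upwards [hne] with y hy
      have hr : 0 < ‖y‖ := norm_pos_iff.mpr hy
      refine tendsto_const_nhds.congr' ?_
      have e1 : ∀ᶠ k in atTop, 2 ≤ a k * ‖y‖ :=
        (hat.atTop_mul_const hr).eventually_ge_atTop 2
      have e2 : ∀ᶠ k in atTop, (a k)⁻¹ * ‖y‖ < 1 := by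
        have := hait.mul_const ‖y‖
        rw [zero_mul] at this
        exact this.eventually (gt_mem_nhds one_pos)
      filter_upwards [e1, e2] with k h1 h2
      simp [cc, th_one h1, th_zero h2.le]
  have t2 := II_lim hG h0 a 0 (fun y hy => by
    refine h0.comp ?_
    rw [← Metric.cobounded_eq_cocompact, ← comap_norm_atTop, tendsto_comap_iff]
    have : (norm ∘ fun k => a k • y) = fun k => a k * ‖y‖ := by
      funext k
      simp only [Function.comp_apply, norm_smul, Real.norm_eq_abs]
      rw [abs_of_pos (by linarith [ha1 k])]
    rw [this]
    exact hat.atTop_mul_const (norm_pos_iff.mpr hy))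
  have t3 := II_lim hG h0 (fun k => (a k)⁻¹) (ψ (ts, xs)) (fun y hy => by
    have e : GG ψ ts lam xs 0 = ψ (ts, xs) := by simp [GG]
    rw [← e]
    refine hG.continuousAt.tendsto.comp ?_
    simpa using hait.smul_const y)
  have t4 := t2.sub t3
  have := tendsto_nhds_unique t1 (t4.congr fun k => (cc_id hψ ts lam hl xs hG hF (ha1 k)).symm)
  rw [this]; ring

lemma GG_cont {ψ : ℝ × E3 → ℝ} (hψ : ContDiff ℝ 2 ψ) (ts lam : ℝ) (xs : E3) :
    Continuous (GG ψ ts lam xs) := by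
  have hp : Continuous (fun y : E3 => ((ts + lam * ‖y‖, y + xs) : ℝ × E3)) := by fun_prop
  have hD (v) : Continuous (fun y : E3 => fderiv ℝ ψ (ts + lam * ‖y‖, y + xs) v) :=
    (contDiff_D hψ v).continuous.comp hp
  have h0 := hψ.continuous.comp hp
  unfold GG
  refine ((continuous_finsetSum _ fun i _ => ?_).sub ?_).add h0
  · exact Continuous.mul (by fun_prop) (hD _)
  · exact Continuous.mul (by fun_prop) (hD _)

lemma BB_cont {ψ : ℝ × E3 → ℝ} (hψ : ContDiff ℝ 2 ψ) (ts lam : ℝ) (xs : E3) :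
    Continuous (BB ψ ts lam xs) := by
  have hp : Continuous (fun y : E3 => ((ts + lam * ‖y‖, y + xs) : ℝ × E3)) := by fun_prop
  have hD (v w) : Continuous (fun y : E3 =>
      fderiv ℝ (fun p => fderiv ℝ ψ p v) (ts + lam * ‖y‖, y + xs) w) :=
    ((((contDiff_D hψ v).continuous_fderiv (by norm_num))).comp hp).clm_apply continuous_const
  unfold BB
  simp only [BB_eq hψ]
  exact (continuous_finsetSum _ fun i _ => hD _ _).sub (hD _ _)

lemma GG_tendsto {ψ : ℝ × E3 → ℝ} (hψ : ContDiff ℝ 2 ψ) (ts lam : ℝ) (hl : lam = -1 ∨ lam = 1)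
    (xs : E3) (hd : Decay ψ ts lam xs) : Tendsto (GG ψ ts lam xs) (cocompact E3) (nhds 0) := by
  obtain ⟨rs, hrs, ⟨p0, C0, hp0, hC0, h0⟩, ⟨p1, C1, hp1, hC1, h1⟩, -⟩ := hd
  have hdf : Differentiable ℝ ψ := hψ.differentiable (by norm_num)
  have hla : |lam| = 1 := by rcases hl with rfl | rfl <;> simp
  have hN : Tendsto (fun y : E3 => ‖y‖) (cocompact E3) atTop := tendsto_norm_cocompact_atTop
  have hb : Tendsto (fun y : E3 => 4 * C1 * ‖y‖ ^ (-(p1 - 1)) + C0 * ‖y‖ ^ (-p0)) (cocompact E3)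
      (nhds 0) := by
    have t1 := ((tendsto_rpow_neg_atTop (sub_pos.mpr hp1)).comp hN).const_mul (4 * C1)
    have t2 := ((tendsto_rpow_neg_atTop hp0).comp hN).const_mul C0
    simpa using t1.add t2
  refine squeeze_zero_norm' ?_ hb
  filter_upwards [hN.eventually_gt_atTop rs] with y hy
  have hr : 0 < ‖y‖ := hrs.trans hy
  have h0' := h0 (y + xs) (by simpa using hy)
  have h1' := h1 (y + xs) (by simpa using hy)
  simp only [add_sub_cancel_right, pdT_eq_s16 hdf, pdX_eq_s16 hdf] at h0' h1'
  obtain ⟨hT, hX⟩ := h1'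
  have e : ‖y‖ ^ (-(p1 - 1)) = ‖y‖ * ‖y‖ ^ (-p1) := by
    rw [neg_sub, sub_eq_add_neg, Real.rpow_add hr, Real.rpow_one]
  rw [e]
  have hterm (i : Fin 3) : |y i * fderiv ℝ ψ (ts + lam * ‖y‖, y + xs) (0, ee i)|
      ≤ ‖y‖ * (C1 * ‖y‖ ^ (-p1)) := by
    rw [abs_mul]
    exact mul_le_mul (PiLp.norm_apply_le y i) (hX i) (abs_nonneg _) hr.le
  have hT' : |lam * ‖y‖ * fderiv ℝ ψ (ts + lam * ‖y‖, y + xs) (1, 0)|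
      ≤ ‖y‖ * (C1 * ‖y‖ ^ (-p1)) := by
    rw [abs_mul, abs_mul, hla, one_mul, abs_of_pos hr]
    exact mul_le_mul_of_nonneg_left hT hr.le
  unfold GG
  rw [Real.norm_eq_abs, Fin.sum_univ_three]
  have a0 := abs_le.mp (hterm 0)
  have a1 := abs_le.mp (hterm 1)
  have a2 := abs_le.mp (hterm 2)
  have a3 := abs_le.mp hT'
  have a4 := abs_le.mp h0'
  rw [abs_le]; constructor <;> linarith

lemma FF_int {ψ : ℝ × E3 → ℝ} (hψ : ContDiff ℝ 2 ψ) (ts lam : ℝ)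
    (xs : E3) (hd : Decay ψ ts lam xs) : Integrable (fun y : E3 => BB ψ ts lam xs y / ‖y‖) := by
  obtain ⟨rs, hrs, -, -, ⟨p, C, hp, hC, h⟩⟩ := hd
  have hB := BB_cont hψ ts lam xs
  rw [← integrableOn_univ, ← Set.union_compl_self (Metric.ball (0:E3) (rs + 1)), integrableOn_union]
  constructor
  · have hinv : IntegrableOn (fun y : E3 => (‖y‖)⁻¹) (Metric.ball (0:E3) (rs + 1)) := by
      rw [integrableOn_fun_norm_addHaar volume (f := fun r => r⁻¹)]
      have : IntegrableOn (fun y : ℝ => y) (Set.Ioo 0 (rs + 1)) :=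
        (continuous_id.integrableOn_Icc (a := 0) (b := rs + 1)).mono_set Set.Ioo_subset_Icc_self
      refine this.congr_fun (fun y hy => ?_) measurableSet_Ioo
      have : y ≠ 0 := hy.1.ne'
      simp
      field_simp
    obtain ⟨M, hM⟩ := (isCompact_closedBall (0:E3) (rs + 1)).exists_bound_of_continuousOn hB.continuousOn
    simp only [div_eq_mul_inv]
    refine Integrable.bdd_mul (c := M) hinv hB.aestronglyMeasurable ?_
    filter_upwards [ae_restrict_mem measurableSet_ball] with y hy
    exact hM y (Metric.ball_subset_closedBall hy)
  · have hg : Integrable (fun y : E3 => 4 * C * 2 ^ (p + 1) * (1 + ‖y‖) ^ (-(p + 1))) :=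
      (integrable_one_add_norm (by simp; linarith)).const_mul _
    refine Integrable.mono' hg.integrableOn ?_ ?_
    · exact (hB.measurable.div measurable_norm).aestronglyMeasurable
    · filter_upwards [ae_restrict_mem measurableSet_ball.compl] with y hy
      have hy1 : rs + 1 ≤ ‖y‖ := by simpa using hy
      have hr : 0 < ‖y‖ := by linarith
      have h' := h (y + xs) (by simp; linarith)
      simp only [add_sub_cancel_right] at h'
      obtain ⟨hT, hX⟩ := h'
      have hBB : |BB ψ ts lam xs y| ≤ 4 * (C * ‖y‖ ^ (-p)) := by
        unfold BB dAlem
        rw [Fin.sum_univ_three]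
        have a0 := abs_le.mp (hX 0)
        have a1 := abs_le.mp (hX 1)
        have a2 := abs_le.mp (hX 2)
        have a3 := abs_le.mp hT
        rw [abs_le]; constructor <;> linarith
      rw [norm_div, Real.norm_eq_abs, norm_norm]
      have e1 : ‖y‖ ^ (-(p + 1)) = ‖y‖ ^ (-p) / ‖y‖ := by
        rw [neg_add, Real.rpow_add hr, Real.rpow_neg_one, div_eq_mul_inv]
      have e2 : ‖y‖ ^ (-(p + 1)) ≤ 2 ^ (p + 1) * (1 + ‖y‖) ^ (-(p + 1)) := by
        have e3 : (2 * ‖y‖) ^ (-(p + 1)) ≤ (1 + ‖y‖) ^ (-(p + 1)) :=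
          Real.rpow_le_rpow_of_nonpos (by linarith) (by linarith) (by linarith)
        rw [Real.mul_rpow (by norm_num) hr.le] at e3
        have e4 : (2:ℝ) ^ (p + 1) * 2 ^ (-(p + 1)) = 1 := by
          rw [← Real.rpow_add (by norm_num)]; simp
        calc ‖y‖ ^ (-(p + 1)) = 2 ^ (p + 1) * (2 ^ (-(p + 1)) * ‖y‖ ^ (-(p + 1))) := by
              rw [← mul_assoc, e4, one_mul]
          _ ≤ _ := by gcongr
      calc |BB ψ ts lam xs y| / ‖y‖ ≤ 4 * (C * ‖y‖ ^ (-p)) / ‖y‖ := by gcongr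
        _ = 4 * C * ‖y‖ ^ (-(p + 1)) := by rw [e1]; ring
        _ ≤ 4 * C * (2 ^ (p + 1) * (1 + ‖y‖) ^ (-(p + 1))) := by gcongr
        _ = _ := by ring

/-- the non-dispersive (retarded for λ = -1, advanced for λ = 1) solution
formula of the inhomogeneous wave equation in three-dimensional space. -/
theorem stmt_16 (lam : ℝ) (hlam : lam = -1 ∨ lam = 1)
    (ts : ℝ) (xs : EuclideanSpace ℝ (Fin 3))
    (ψ : ℝ × EuclideanSpace ℝ (Fin 3) → ℝ) (hψ : ContDiff ℝ 2 ψ)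
    (hdecay : Decay ψ ts lam xs) :
    Integrable (fun x : EuclideanSpace ℝ (Fin 3) =>
      dAlem ψ (ts + lam * ‖x - xs‖, x) / ‖x - xs‖) ∧
    ψ (ts, xs) = -(1 / (4 * Real.pi)) * ∫ x : EuclideanSpace ℝ (Fin 3),
      dAlem ψ (ts + lam * ‖x - xs‖, x) / ‖x - xs‖ := by
  have hF := FF_int hψ ts lam xs hdecay
  have hI := final_id hψ ts lam hlam xs (GG_cont hψ ts lam xs)
    (GG_tendsto hψ ts lam hlam xs hdecay) hF
  have e : (fun x : EuclideanSpace ℝ (Fin 3) => dAlem ψ (ts + lam * ‖x - xs‖, x) / ‖x - xs‖)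
      = fun x => (fun y : E3 => BB ψ ts lam xs y / ‖y‖) (x - xs) := by
    funext x
    simp [BB]
  refine ⟨?_, ?_⟩
  · rw [e]
    exact hF.comp_sub_right xs
  · rw [e, integral_sub_right_eq_self (fun y : E3 => BB ψ ts lam xs y / ‖y‖) xs, hI]
    have := Real.pi_ne_zero
    field_simp
end
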